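/- Let n ≥ 2 and 0 < α < 2. Suppose u ∈ L_α is α-harmonic in the sense of distributions and u(x) ≥ 0 for almost every x ∈ ℝⁿ. Then u is almost everywhere equal to a constant. -/

import Mathlib

open MeasureTheory Filter Topology Metric

noncomputable section

/-- Membership in the space `L_α`. -/
def InLalpha (n : ℕ) (α : ℝ) (u : EuclideanSpace ℝ (Fin n) → ℝ) : Prop :=
  Integrable (fun x : EuclideanSpace ℝ (Fin n) => u x / (1 + ‖x‖ ^ ((n : ℝ) + α)))

/-- Principal-value fractional Laplacian (up to the normalizing constant). -/
def IsFracLapAt (n : ℕ) (α : ℝ) (φ : EuclideanSpace ℝ (Fin n) → ℝ)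
    (x : EuclideanSpace ℝ (Fin n)) (L : ℝ) : Prop :=
  Tendsto (fun ε : ℝ =>
      ∫ z in {z : EuclideanSpace ℝ (Fin n) | ε < ‖x - z‖},
        (φ x - φ z) / ‖x - z‖ ^ ((n : ℝ) + α))
    (𝓝[>] 0) (𝓝 L)

/-- `α`-harmonicity in the sense of distributions. -/
def AlphaHarmonic (n : ℕ) (α : ℝ) (u : EuclideanSpace ℝ (Fin n) → ℝ) : Prop :=
  ∀ φ : EuclideanSpace ℝ (Fin n) → ℝ, ContDiff ℝ (⊤ : ℕ∞) φ → HasCompactSupport φ →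
    ∀ g : EuclideanSpace ℝ (Fin n) → ℝ,
      (∀ x, IsFracLapAt n α φ x (g x)) → ∫ x, u x * g x = 0

open scoped ContDiff

/-- Local shorthand for `n`-dimensional Euclidean space. -/
abbrev Eucl (n : ℕ) : Type := EuclideanSpace ℝ (Fin n)

/-- The symmetric second difference of `f` at `x` with step `y`. -/
def secDiff {n : ℕ} (f : Eucl n → ℝ) (x y : Eucl n) : ℝ :=
  2 * f x - f (x + y) - f (x - y)

lemma exists_abs_secDiff_le {n : ℕ} {f : Eucl n → ℝ} (hf : ContDiff ℝ ∞ f)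
    (hc : HasCompactSupport f) : ∃ C, 0 ≤ C ∧ ∀ x y, |secDiff f x y| ≤ C * ‖y‖ ^ 2 := by
  obtain ⟨C, hC⟩ := ContDiff.lipschitzWith_of_hasCompactSupport (𝕂 := ℝ) (n := ∞)
    (hc.fderiv (𝕜 := ℝ)) (hf.fderiv_right (by simp)) (by simp)
  have hd : Differentiable ℝ f := hf.differentiable (by simp)
  refine ⟨C, C.2, fun x y => ?_⟩
  have hder : ∀ z, HasFDerivAt (fun z => f (z + y) - f z) (fderiv ℝ f (z + y) - fderiv ℝ f z) z := by
    intro z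
    exact ((hasFDerivAt_comp_add_right y).2 (hd (z + y)).hasFDerivAt).sub (hd z).hasFDerivAt
  have key := convex_univ.norm_image_sub_le_of_norm_hasFDerivWithin_le
    (f := fun z => f (z + y) - f z) (f' := fun z => fderiv ℝ f (z + y) - fderiv ℝ f z)
    (C := C * ‖y‖) (fun z _ => (hder z).hasFDerivWithinAt)
    (fun z _ => by simpa [dist_eq_norm] using hC.dist_le_mul (z + y) z)
    (Set.mem_univ x) (Set.mem_univ (x - y))
  have h2 : x - y - x = -y := by abel
  rw [h2, norm_neg, Real.norm_eq_abs, sub_add_cancel] at key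
  have : secDiff f x y = f x - f (x - y) - (f (x + y) - f x) := by unfold secDiff; ring
  rw [this]
  linarith

/-- The majorant `min (1, ‖y‖²) / ‖y‖ ^ (n + α)` of a second difference over the singular kernel. -/
def levyWeight (n : ℕ) (α : ℝ) (y : Eucl n) : ℝ :=
  min 1 (‖y‖ ^ 2) / ‖y‖ ^ ((n : ℝ) + α)

lemma levyWeight_nonneg (n : ℕ) (α : ℝ) (y : Eucl n) : 0 ≤ levyWeight n α y := by
  unfold levyWeight; positivity

lemma integrable_levyWeight {n : ℕ} {α : ℝ} (hn : 1 ≤ n) (hα0 : 0 < α) (hα2 : α < 2) :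
    Integrable (levyWeight n α) := by
  have : Nonempty (Fin n) := ⟨⟨0, hn⟩⟩
  have hdim : Module.finrank ℝ (Eucl n) = n := by simp
  refine (integrable_fun_norm_addHaar (E := Eucl n) volume
    (f := fun r : ℝ => min 1 (r ^ 2) / r ^ ((n : ℝ) + α))).2 ?_
  rw [hdim, ← Set.Ioc_union_Ioi_eq_Ioi (zero_le_one (α := ℝ))]
  have hpow : ∀ r : ℝ, 0 < r → r ^ (n - 1) = r ^ ((n : ℝ) - 1) := by
    intro r hr
    rw [← Real.rpow_natCast, Nat.cast_sub hn, Nat.cast_one]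
  refine IntegrableOn.union ?_ ?_
  · have h1 : IntegrableOn (fun r : ℝ => r ^ (1 - α)) (Set.Ioc 0 1) := by
      rw [← intervalIntegrable_iff_integrableOn_Ioc_of_le zero_le_one]
      exact intervalIntegral.intervalIntegrable_rpow' (by linarith)
    refine h1.congr_fun ?_ measurableSet_Ioc
    intro r hr
    have h0 : 0 < r := hr.1
    have : min 1 (r ^ 2) = r ^ 2 := min_eq_right (by nlinarith [hr.2])
    simp only [smul_eq_mul, this]
    rw [hpow r h0, ← Real.rpow_natCast, ← Real.rpow_sub h0, ← Real.rpow_add h0]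
    congr 1; push_cast; ring
  · have h1 : IntegrableOn (fun r : ℝ => r ^ (-1 - α)) (Set.Ioi 1) :=
      integrableOn_Ioi_rpow_of_lt (by linarith) one_pos
    refine h1.congr_fun ?_ measurableSet_Ioi
    intro r hr
    have h1 : 1 < r := hr
    have h0 : 0 < r := by linarith
    have : min 1 (r ^ 2) = 1 := min_eq_left (by nlinarith)
    simp only [smul_eq_mul, this]
    rw [hpow r h0, one_div, ← Real.rpow_neg h0.le, ← Real.rpow_add h0]
    congr 1; ring

/-- The fractional Laplacian (up to the normalizing constant) as an absolutely convergent integral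
of second differences. -/
def fracLap (n : ℕ) (α : ℝ) (f : Eucl n → ℝ) (x : Eucl n) : ℝ :=
  2⁻¹ * ∫ y, secDiff f x y / ‖y‖ ^ ((n : ℝ) + α)

section FracLap

variable {n : ℕ} {α : ℝ} {f : Eucl n → ℝ}

lemma continuous_secDiff (hf : Continuous f) :
    Continuous fun p : Eucl n × Eucl n => secDiff f p.1 p.2 := by
  unfold secDiff; fun_prop

lemma exists_abs_secDiff_div_le (hf : ContDiff ℝ ∞ f) (hc : HasCompactSupport f) :
    ∃ C, 0 ≤ C ∧ ∀ x y, |secDiff f x y / ‖y‖ ^ ((n : ℝ) + α)| ≤ C * levyWeight n α y := by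
  obtain ⟨C, hC0, hC⟩ := exists_abs_secDiff_le hf hc
  obtain ⟨B, hB⟩ := hc.exists_bound_of_continuous hf.continuous
  have hB0 : 0 ≤ B := (norm_nonneg _).trans (hB 0)
  refine ⟨C + 4 * B, by positivity, fun x y => ?_⟩
  have hp : (0 : ℝ) ≤ ‖y‖ ^ ((n : ℝ) + α) := by positivity
  rw [abs_div, abs_of_nonneg hp, levyWeight, ← mul_div_assoc]
  refine div_le_div_of_nonneg_right ?_ hp
  rcases le_total 1 (‖y‖ ^ 2) with h | h
  · rw [min_eq_left h]
    have h1 := abs_le.1 (hB x)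
    have h2 := abs_le.1 (hB (x + y))
    have h3 := abs_le.1 (hB (x - y))
    unfold secDiff
    rw [abs_le]
    constructor <;> linarith [h1.1, h1.2, h2.1, h2.2, h3.1, h3.2]
  · rw [min_eq_right h]
    have := hC x y
    nlinarith [sq_nonneg ‖y‖, mul_nonneg hB0 (sq_nonneg ‖y‖)]

lemma integrable_secDiff_div (hn : 1 ≤ n) (hα0 : 0 < α) (hα2 : α < 2) (hf : ContDiff ℝ ∞ f)
    (hc : HasCompactSupport f) (x : Eucl n) :
    Integrable fun y => secDiff f x y / ‖y‖ ^ ((n : ℝ) + α) := by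
  obtain ⟨C, hC0, hC⟩ := exists_abs_secDiff_div_le (α := α) hf hc
  refine ((integrable_levyWeight hn hα0 hα2).const_mul C).mono' ?_ (.of_forall fun y => hC x y)
  have h1 : Measurable fun y => secDiff f x y :=
    ((continuous_secDiff hf.continuous).comp (by fun_prop : Continuous fun y => (x, y))).measurable
  exact (h1.div (by fun_prop)).aestronglyMeasurable

lemma isFracLapAt_fracLap (hn : 1 ≤ n) (hα0 : 0 < α) (hα2 : α < 2) (hf : ContDiff ℝ ∞ f)
    (hc : HasCompactSupport f) (x : Eucl n) : IsFracLapAt n α f x (fracLap n α f x) := by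
  have hsd := integrable_secDiff_div hn hα0 hα2 hf hc x
  have hmeas : ∀ ε : ℝ, MeasurableSet {y : Eucl n | ε < ‖y‖} := fun ε =>
    measurableSet_lt measurable_const measurable_norm
  have hlim : Tendsto (fun ε : ℝ => ∫ y, {y : Eucl n | ε < ‖y‖}.indicator
      (fun y => secDiff f x y / ‖y‖ ^ ((n : ℝ) + α)) y) (𝓝[>] 0)
      (𝓝 (∫ y, secDiff f x y / ‖y‖ ^ ((n : ℝ) + α))) := by
    refine tendsto_integral_filter_of_dominated_convergence
      (fun y => ‖secDiff f x y / ‖y‖ ^ ((n : ℝ) + α)‖)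
      (.of_forall fun ε => hsd.aestronglyMeasurable.indicator (hmeas ε))
      (.of_forall fun ε => .of_forall fun y => norm_indicator_le_norm_self _ _) hsd.norm ?_
    refine .of_forall fun y => ?_
    rcases eq_or_ne y 0 with rfl | hy
    · have : secDiff f x 0 = 0 := by simp [secDiff]; ring
      simp [this, Set.indicator]
    · refine tendsto_const_nhds.congr' ?_
      have : ∀ᶠ ε : ℝ in 𝓝[>] 0, ε < ‖y‖ :=
        nhdsWithin_le_nhds (eventually_lt_nhds (norm_pos_iff.2 hy))
      filter_upwards [this] with ε hε
      rw [Set.indicator_of_mem (by exact hε)]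
  refine (hlim.const_mul 2⁻¹).congr' ?_
  filter_upwards [self_mem_nhdsWithin] with ε hε
  have hε : 0 < ε := hε
  obtain ⟨B, hB⟩ := hc.exists_bound_of_continuous hf.continuous
  let F : Eucl n → ℝ := {y : Eucl n | ε < ‖y‖}.indicator
    fun y => (f x - f (x + y)) / ‖y‖ ^ ((n : ℝ) + α)
  have hF : Integrable F := by
    refine ((integrable_levyWeight hn hα0 hα2).const_mul (2 * B * (1 + ε⁻¹ ^ 2))).mono' ?_ ?_
    · have := hf.continuous.measurable
      exact (Measurable.indicator (by fun_prop) (hmeas ε)).aestronglyMeasurable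
    · refine .of_forall fun y => ?_
      have hB0 : 0 ≤ B := (norm_nonneg _).trans (hB 0)
      by_cases hy : ε < ‖y‖
      · have hp : (0 : ℝ) ≤ ‖y‖ ^ ((n : ℝ) + α) := by positivity
        simp only [F]
        rw [Set.indicator_of_mem (by exact hy), norm_div, Real.norm_of_nonneg hp, levyWeight,
          ← mul_div_assoc]
        refine div_le_div_of_nonneg_right ?_ hp
        have h1 : ‖f x - f (x + y)‖ ≤ 2 * B := by
          have := norm_sub_le (f x) (f (x + y))
          linarith [hB x, hB (x + y)]
        have h2 : 1 ≤ (1 + ε⁻¹ ^ 2) * min 1 (‖y‖ ^ 2) := by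
          rcases le_total 1 (‖y‖ ^ 2) with h | h
          · rw [min_eq_left h]; nlinarith [sq_nonneg ε⁻¹]
          · rw [min_eq_right h]
            have : 1 ≤ ε⁻¹ ^ 2 * ‖y‖ ^ 2 := by
              rw [← mul_pow]
              refine one_le_pow₀ ?_
              rw [inv_mul_eq_div, one_le_div hε]; exact hy.le
            nlinarith [sq_nonneg ‖y‖]
        calc ‖f x - f (x + y)‖ ≤ 2 * B := h1
          _ ≤ 2 * B * ((1 + ε⁻¹ ^ 2) * min 1 (‖y‖ ^ 2)) := le_mul_of_one_le_right (by positivity) h2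
          _ = _ := by ring
      · simp only [F]
        rw [Set.indicator_of_notMem (by exact hy), norm_zero]
        have := levyWeight_nonneg n α y
        positivity
  have hsplit : ∀ y, {y : Eucl n | ε < ‖y‖}.indicator
      (fun y => secDiff f x y / ‖y‖ ^ ((n : ℝ) + α)) y = F y + F (-y) := by
    intro y
    by_cases hy : ε < ‖y‖
    · simp only [F, Set.indicator, Set.mem_ofPred_eq, norm_neg, hy, if_true, secDiff, sub_eq_add_neg]
      ring
    · simp [F, Set.indicator, hy]
  simp only [hsplit]
  rw [integral_add hF hF.comp_neg, integral_neg_eq_self F volume,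
    ← integral_indicator (measurableSet_lt measurable_const (by fun_prop)),
    ← two_mul, ← mul_assoc,
    inv_mul_cancel₀ two_ne_zero, one_mul, ← integral_sub_right_eq_self F x]
  refine integral_congr_ae (.of_forall fun y => ?_)
  simp [F, Set.indicator, norm_sub_rev]

end FracLap

/-- The weight `(1 + ‖x‖) ^ (-(n + α))` describing the decay of the fractional Laplacian of a
compactly supported function. -/
def decay {n : ℕ} (α : ℝ) (x : Eucl n) : ℝ :=
  (1 + ‖x‖) ^ (-((n : ℝ) + α))

/-- A smooth bump function at the origin, equal to `1` on the ball of radius `1 / 2` and supported in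
the unit ball. -/
def unitBump (n : ℕ) : ContDiffBump (0 : Eucl n) :=
  ⟨1 / 2, 1, by norm_num, by norm_num⟩

/-- The fractional Laplacian of the bump function `unitBump n`. -/
def bumpLap (n : ℕ) (α : ℝ) : Eucl n → ℝ :=
  fracLap n α (unitBump n)

section Decay

variable {n : ℕ} {α : ℝ}

lemma decay_pos (x : Eucl n) : 0 < decay α x := by
  unfold decay; positivity

lemma continuous_decay : Continuous (decay α : Eucl n → ℝ) := by
  unfold decay
  exact (by fun_prop : Continuous fun x : Eucl n => 1 + ‖x‖).rpow_const
    fun x => Or.inl (by positivity)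

lemma decay_neg (x : Eucl n) : decay α (-x) = decay α x := by
  simp [decay]

lemma decay_le_one (hα0 : 0 < α) (x : Eucl n) : decay α x ≤ 1 :=
  Real.rpow_le_one_of_one_le_of_nonpos (by simp) (by have := n.cast_nonneg (α := ℝ); linarith)

lemma decay_le_mul (hα0 : 0 < α) {a : ℝ} (ha : 0 < a) {x y : Eucl n}
    (h : 1 + ‖x‖ ≤ a * (1 + ‖y‖)) : decay α y ≤ a ^ ((n : ℝ) + α) * decay α x := by
  have hn := n.cast_nonneg (α := ℝ)
  have h1 : (1 + ‖x‖) ^ ((n : ℝ) + α) ≤ a ^ ((n : ℝ) + α) * (1 + ‖y‖) ^ ((n : ℝ) + α) := by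
    rw [← Real.mul_rpow ha.le (by positivity)]
    exact Real.rpow_le_rpow (by positivity) h (by linarith)
  unfold decay
  rw [Real.rpow_neg (by positivity), Real.rpow_neg (by positivity), ← div_eq_mul_inv,
    le_div_iff₀ (by positivity), inv_mul_le_iff₀ (by positivity)]
  linarith

lemma decay_add_le (hα0 : 0 < α) (x y : Eucl n) :
    decay α (x + y) ≤ (1 + ‖y‖) ^ ((n : ℝ) + α) * decay α x := by
  refine decay_le_mul hα0 (by positivity) ?_
  have : ‖x‖ ≤ ‖x + y‖ + ‖y‖ := by simpa using norm_sub_le (x + y) y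
  nlinarith [norm_nonneg (x + y), norm_nonneg y]

lemma exists_decay_affine_le (hα0 : 0 < α) (x₀ : Eucl n) {δ : ℝ} (hδ : 0 < δ) :
    ∃ C, 0 < C ∧ ∀ x, decay α (δ⁻¹ • (x - x₀)) ≤ C * decay α x := by
  refine ⟨(1 + ‖x₀‖ + δ) ^ ((n : ℝ) + α), by positivity, fun x => ?_⟩
  refine decay_le_mul hα0 (by positivity) ?_
  rw [norm_smul, norm_inv, Real.norm_of_nonneg hδ.le]
  have h1 : ‖x‖ ≤ ‖x - x₀‖ + ‖x₀‖ := by simpa using norm_add_le (x - x₀) x₀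
  have h2 : δ * (δ⁻¹ * ‖x - x₀‖) = ‖x - x₀‖ := by field_simp
  have h3 : 0 ≤ δ⁻¹ * ‖x - x₀‖ := by positivity
  nlinarith [norm_nonneg x₀, mul_nonneg (norm_nonneg x₀) h3]

lemma le_decay_smul (hα0 : 0 < α) {δ : ℝ} (hδ : 0 < δ) (hδ1 : δ ≤ 1) (x : Eucl n) :
    δ ^ ((n : ℝ) + α) * decay α x ≤ decay α (δ⁻¹ • x) := by
  have : decay α x ≤ (δ⁻¹) ^ ((n : ℝ) + α) * decay α (δ⁻¹ • x) := by
    refine decay_le_mul hα0 (by positivity) ?_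
    rw [norm_smul, norm_inv, Real.norm_of_nonneg hδ.le]
    have h1 : 1 ≤ δ⁻¹ := (one_le_inv₀ hδ).2 hδ1
    have h2 : 0 ≤ δ⁻¹ * ‖x‖ := by positivity
    nlinarith
  rw [Real.inv_rpow hδ.le, inv_mul_eq_div, le_div_iff₀ (by positivity)] at this
  linarith

lemma continuous_unitBump : Continuous (unitBump n) := (unitBump n).continuous

lemma unitBump_eq_zero {x : Eucl n} (hx : 1 ≤ ‖x‖) : unitBump n x = 0 :=
  (unitBump n).zero_of_le_dist (by simpa [unitBump] using hx)

lemma unitBump_eq_one {x : Eucl n} (hx : ‖x‖ ≤ 1 / 2) : unitBump n x = 1 :=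
  (unitBump n).one_of_mem_closedBall (by simpa [unitBump] using hx)

lemma stronglyMeasurable_bumpLap : StronglyMeasurable (bumpLap n α) := by
  have h1 : Measurable fun p : Eucl n × Eucl n =>
      secDiff (unitBump n) p.1 p.2 / ‖p.2‖ ^ ((n : ℝ) + α) :=
    (continuous_secDiff continuous_unitBump).measurable.div (by fun_prop)
  exact (h1.stronglyMeasurable.integral_prod_right (ν := volume)).const_mul _

lemma exists_abs_bumpLap_le_const (hn : 1 ≤ n) (hα0 : 0 < α) (hα2 : α < 2) :
    ∃ C, 0 < C ∧ ∀ x, |bumpLap n α x| ≤ C := by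
  obtain ⟨C, hC0, hC⟩ := exists_abs_secDiff_div_le (α := α) (unitBump n).contDiff
    (unitBump n).hasCompactSupport
  have hI := integrable_levyWeight hn hα0 hα2
  have hI0 : 0 ≤ ∫ y, levyWeight n α y := integral_nonneg (levyWeight_nonneg n α)
  refine ⟨2⁻¹ * (C * ∫ y, levyWeight n α y) + 1, by positivity, fun x => ?_⟩
  have : |∫ y, secDiff (unitBump n) x y / ‖y‖ ^ ((n : ℝ) + α)| ≤ C * ∫ y, levyWeight n α y := by
    rw [← integral_const_mul, ← Real.norm_eq_abs]
    exact norm_integral_le_of_norm_le (hI.const_mul C) (.of_forall fun y => hC x y)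
  unfold bumpLap fracLap
  rw [abs_mul, abs_of_pos (by norm_num : (0 : ℝ) < 2⁻¹)]
  linarith

lemma secDiff_unitBump_of_one_le {x : Eucl n} (hx : 1 ≤ ‖x‖) (y : Eucl n) :
    secDiff (unitBump n) x y = -(unitBump n (x + y) + unitBump n (x - y)) := by
  simp only [secDiff, unitBump_eq_zero hx]; ring

lemma bumpLap_le_neg (hn : 1 ≤ n) (hα0 : 0 < α) (hα2 : α < 2) {x : Eucl n} (hx : 1 ≤ ‖x‖) :
    bumpLap n α x ≤ -(2⁻¹ * volume.real (ball (0 : Eucl n) (1 / 2)) * decay α x) := by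
  have hsd := integrable_secDiff_div hn hα0 hα2 (unitBump n).contDiff
    (unitBump n).hasCompactSupport x
  have hvol : volume.real (ball (0 : Eucl n) (1 / 2)) = volume.real (ball (-x) (1 / 2)) := by
    simp [measureReal_def, Measure.addHaar_ball_center (volume : Measure (Eucl n)) (-x)]
  have hneg : ∀ y, 0 ≤ -(secDiff (unitBump n) x y / ‖y‖ ^ ((n : ℝ) + α)) := by
    intro y
    rw [secDiff_unitBump_of_one_le hx, ← neg_div, neg_neg]
    have := (unitBump n).nonneg (x := x + y)
    have := (unitBump n).nonneg (x := x - y)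
    positivity
  have hlow : volume.real (ball (-x) (1 / 2)) * decay α x
      ≤ ∫ y, -(secDiff (unitBump n) x y / ‖y‖ ^ ((n : ℝ) + α)) := by
    calc volume.real (ball (-x) (1 / 2)) * decay α x
        = ∫ y in ball (-x) (1 / 2), decay α x := by simp
      _ ≤ ∫ y in ball (-x) (1 / 2), -(secDiff (unitBump n) x y / ‖y‖ ^ ((n : ℝ) + α)) := by
          refine setIntegral_mono_on (integrableOn_const measure_ball_lt_top.ne)
            hsd.neg.integrableOn measurableSet_ball ?_
          intro y hy
          rw [mem_ball, dist_eq_norm, sub_neg_eq_add, add_comm] at hy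
          rw [secDiff_unitBump_of_one_le hx, unitBump_eq_one hy.le, ← neg_div, neg_neg, decay,
            Real.rpow_neg (by positivity), ← one_div]
          have h0 := (unitBump n).nonneg (x := x - y)
          have h1 : ‖y‖ ≤ 1 + ‖x‖ := by
            have := norm_sub_le (x + y) x
            rw [add_sub_cancel_left] at this
            linarith
          have h2 : 0 < ‖y‖ := by
            have := norm_sub_le (x + y) y
            rw [add_sub_cancel_right] at this
            linarith
          have hn0 := n.cast_nonneg (α := ℝ)
          exact div_le_div₀ (by positivity) (by linarith) (by positivity)
            (Real.rpow_le_rpow h2.le h1 (by linarith))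
      _ ≤ _ := setIntegral_le_integral hsd.neg (.of_forall hneg)
  rw [integral_neg] at hlow
  unfold bumpLap fracLap
  rw [hvol]
  linarith

lemma exists_bumpLap_bounds (hn : 1 ≤ n) (hα0 : 0 < α) (hα2 : α < 2) :
    ∃ C, 0 < C ∧ ∀ x, |bumpLap n α x| ≤ C * decay α x := by
  obtain ⟨C, hC0, hC⟩ := exists_abs_bumpLap_le_const hn hα0 hα2
  have hb : Integrable (unitBump n) := (unitBump n).integrable
  have hI0 : 0 ≤ ∫ y, unitBump n y := integral_nonneg fun y => (unitBump n).nonneg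
  refine ⟨C * 3 ^ ((n : ℝ) + α) + 3 ^ ((n : ℝ) + α) * ∫ y, unitBump n y, by positivity,
    fun x => ?_⟩
  have hd := decay_pos (α := α) x
  have hn0 := n.cast_nonneg (α := ℝ)
  rcases le_total ‖x‖ 2 with hx | hx
  · have h1 : decay α (0 : Eucl n) ≤ 3 ^ ((n : ℝ) + α) * decay α x :=
      decay_le_mul hα0 (by norm_num) (by simp; linarith)
    have h2 : decay α (0 : Eucl n) = 1 := by simp [decay]
    rw [h2] at h1
    have h3 : (0 : ℝ) ≤ 3 ^ ((n : ℝ) + α) * (∫ y, unitBump n y) * decay α x := by positivity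
    have := mul_le_mul_of_nonneg_left h1 hC0.le
    linarith [hC x]
  · have hp : Integrable fun y => unitBump n (x + y) := hb.comp_add_left x
    have hm : Integrable fun y => unitBump n (x - y) := hb.comp_sub_left x
    have key : |∫ y, secDiff (unitBump n) x y / ‖y‖ ^ ((n : ℝ) + α)|
        ≤ ∫ y, 3 ^ ((n : ℝ) + α) * decay α x * (unitBump n (x + y) + unitBump n (x - y)) := by
      rw [← Real.norm_eq_abs]
      refine norm_integral_le_of_norm_le ((hp.add hm).const_mul _) (.of_forall fun y => ?_)
      have h1 := (unitBump n).nonneg (x := x + y)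
      have h2 := (unitBump n).nonneg (x := x - y)
      rw [secDiff_unitBump_of_one_le (by linarith), norm_div, norm_neg,
        Real.norm_of_nonneg (by positivity), Real.norm_of_nonneg (by positivity)]
      by_cases hy : ‖x‖ - 1 ≤ ‖y‖
      · rw [div_le_iff₀ (by have : 0 < ‖y‖ := by linarith
                            positivity)]
        have h3 : 1 ≤ 3 ^ ((n : ℝ) + α) * decay α x * ‖y‖ ^ ((n : ℝ) + α) := by
          have h4 : (1 + ‖x‖) ^ ((n : ℝ) + α) ≤ (3 * ‖y‖) ^ ((n : ℝ) + α) :=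
            Real.rpow_le_rpow (by positivity) (by linarith) (by linarith)
          rw [Real.mul_rpow (by norm_num) (norm_nonneg _)] at h4
          rw [decay, Real.rpow_neg (by positivity), mul_right_comm, ← div_eq_mul_inv,
            one_le_div (by positivity)]
          exact h4
        nlinarith [add_nonneg h1 h2]
      · have h3 : 1 ≤ ‖x + y‖ := by
          have := norm_sub_le (x + y) y
          rw [add_sub_cancel_right] at this
          linarith
        have h4 : 1 ≤ ‖x - y‖ := by
          have := norm_add_le (x - y) y
          rw [sub_add_cancel] at this
          linarith
        simp [unitBump_eq_zero h3, unitBump_eq_zero h4]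
    rw [integral_const_mul, integral_add hp hm, integral_add_left_eq_self,
      integral_sub_left_eq_self] at key
    unfold bumpLap fracLap
    rw [abs_mul, abs_of_pos (by norm_num : (0 : ℝ) < 2⁻¹)]
    have : (0 : ℝ) ≤ C * 3 ^ ((n : ℝ) + α) * decay α x := by positivity
    nlinarith

lemma fracLap_comp_affine (f : Eucl n → ℝ) (x₀ x : Eucl n) {δ : ℝ} (hδ : 0 < δ) :
    fracLap n α (fun z => f (δ⁻¹ • (z - x₀))) x
      = (δ ^ n * (δ ^ ((n : ℝ) + α))⁻¹) * fracLap n α f (δ⁻¹ • (x - x₀)) := by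
  let G : Eucl n → ℝ := fun y => (δ ^ ((n : ℝ) + α))⁻¹ *
    (secDiff f (δ⁻¹ • (x - x₀)) y / ‖y‖ ^ ((n : ℝ) + α))
  have h : ∀ y, secDiff (fun z => f (δ⁻¹ • (z - x₀))) x y / ‖y‖ ^ ((n : ℝ) + α)
      = G (δ⁻¹ • y) := by
    intro y
    have h1 : secDiff (fun z => f (δ⁻¹ • (z - x₀))) x y
        = secDiff f (δ⁻¹ • (x - x₀)) (δ⁻¹ • y) := by
      simp only [secDiff]
      rw [← smul_add, ← smul_sub, add_sub_right_comm, sub_right_comm x y]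
    have h2 : ‖y‖ = δ * ‖δ⁻¹ • y‖ := by
      rw [norm_smul, norm_inv, Real.norm_of_nonneg hδ.le]; field_simp
    simp only [h1, G]
    rw [h2, Real.mul_rpow hδ.le (norm_nonneg _), div_mul_eq_div_div, div_right_comm,
      inv_mul_eq_div]
  unfold fracLap
  simp only [h]
  rw [Measure.integral_comp_inv_smul_of_nonneg volume G hδ.le, integral_const_mul]
  simp only [finrank_euclideanSpace, Fintype.card_fin, smul_eq_mul]
  ring

end Decay

/-- Weighted integrability together with orthogonality to the fractional Laplacians of all affine
rescalings of the bump function `unitBump n`. -/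
structure BumpHarmonic {n : ℕ} (α : ℝ) (w : Eucl n → ℝ) : Prop where
  integrable : Integrable fun x => w x * decay α x
  dual : ∀ (x₀ : Eucl n) (δ : ℝ), 0 < δ → ∫ x, w x * bumpLap n α (δ⁻¹ • (x - x₀)) = 0

/-- The convolution of `u` with the kernel `ρ`. -/
def mollify {n : ℕ} (ρ u : Eucl n → ℝ) (x : Eucl n) : ℝ :=
  ∫ t, ρ t * u (x - t)

section BumpHarmonic

variable {n : ℕ} {α : ℝ} {u w ρ : Eucl n → ℝ}

lemma integrable_mul_of_le_decay (hw : Integrable fun x => w x * decay α x) {G : Eucl n → ℝ}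
    {C : ℝ} (hG : AEStronglyMeasurable G) (hC : ∀ x, |G x| ≤ C * decay α x) :
    Integrable fun x => w x * G x := by
  have h1 : AEStronglyMeasurable fun x => G x * (decay α x)⁻¹ :=
    hG.mul (continuous_decay.inv₀ fun x => (decay_pos x).ne').aestronglyMeasurable
  refine (hw.mul_bdd (c := C) h1 (.of_forall fun x => ?_)).congr (.of_forall fun x => ?_)
  · rw [norm_mul, norm_inv, Real.norm_of_nonneg (decay_pos x).le, ← div_eq_mul_inv,
      div_le_iff₀ (decay_pos x)]
    exact hC x
  · have := (decay_pos (α := α) x).ne'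
    simp only; field_simp

lemma locallyIntegrable_of_integrable_mul_decay (hw : Integrable fun x => w x * decay α x) :
    LocallyIntegrable w := by
  have h := hw.locallyIntegrable.continuous_mul
    (continuous_decay.inv₀ fun x => (decay_pos x).ne' : Continuous fun x => (decay α x)⁻¹)
  refine h.congr (.of_forall fun x => ?_)
  have := (decay_pos (α := α) x).ne'
  simp only [Pi.inv_apply]; field_simp

lemma integrable_mul_decay_affine (hα0 : 0 < α) (hw : Integrable fun x => w x * decay α x)
    (x₀ : Eucl n) {δ : ℝ} (hδ : 0 < δ) :
    Integrable fun x => w x * decay α (δ⁻¹ • (x - x₀)) := by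
  obtain ⟨C, hC0, hC⟩ := exists_decay_affine_le (n := n) hα0 x₀ hδ
  refine integrable_mul_of_le_decay (C := C) hw
    (continuous_decay.comp (by fun_prop)).aestronglyMeasurable fun x => ?_
  rw [abs_of_pos (decay_pos _)]
  exact hC x

lemma exists_bumpLap_affine_le (hn : 1 ≤ n) (hα0 : 0 < α) (hα2 : α < 2) (x₀ : Eucl n) {δ : ℝ}
    (hδ : 0 < δ) : ∃ C, ∀ x, |bumpLap n α (δ⁻¹ • (x - x₀))| ≤ C * decay α x := by
  obtain ⟨C, hC0, hC⟩ := exists_decay_affine_le (n := n) hα0 x₀ hδ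
  obtain ⟨D, hD0, hD⟩ := exists_bumpLap_bounds hn hα0 hα2
  refine ⟨D * C, fun x => (hD _).trans ?_⟩
  rw [mul_assoc]
  exact mul_le_mul_of_nonneg_left (hC x) hD0.le

lemma aestronglyMeasurable_bumpLap_affine (x₀ : Eucl n) (δ : ℝ) :
    AEStronglyMeasurable fun x => bumpLap n α (δ⁻¹ • (x - x₀)) :=
  (stronglyMeasurable_bumpLap.comp_measurable (by fun_prop)).aestronglyMeasurable

lemma integrable_mul_bumpLap_affine (hn : 1 ≤ n) (hα0 : 0 < α) (hα2 : α < 2)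
    (hw : Integrable fun x => w x * decay α x) (x₀ : Eucl n) {δ : ℝ} (hδ : 0 < δ) :
    Integrable fun x => w x * bumpLap n α (δ⁻¹ • (x - x₀)) := by
  obtain ⟨C, hC⟩ := exists_bumpLap_affine_le hn hα0 hα2 x₀ hδ
  exact integrable_mul_of_le_decay hw (aestronglyMeasurable_bumpLap_affine x₀ δ) hC

lemma AlphaHarmonic.bumpHarmonic (hn : 1 ≤ n) (hα0 : 0 < α) (hα2 : α < 2)
    (hL : InLalpha n α u) (hu : AlphaHarmonic n α u) : BumpHarmonic α u where
  integrable := by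
    have hn0 := n.cast_nonneg (α := ℝ)
    have hc : Continuous fun x : Eucl n => (1 + ‖x‖ ^ ((n : ℝ) + α)) * decay α x :=
      (continuous_const.add (continuous_norm.rpow_const fun x => Or.inr (by linarith))).mul
        continuous_decay
    refine (Integrable.mul_bdd (c := 2) hL hc.aestronglyMeasurable
      (.of_forall fun x => ?_)).congr (.of_forall fun x => ?_)
    · have h1 : (1 : ℝ) ≤ (1 + ‖x‖) ^ ((n : ℝ) + α) :=
        Real.one_le_rpow (by simp) (by linarith)
      have h2 : ‖x‖ ^ ((n : ℝ) + α) ≤ (1 + ‖x‖) ^ ((n : ℝ) + α) :=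
        Real.rpow_le_rpow (norm_nonneg _) (by simp) (by linarith)
      rw [Real.norm_of_nonneg (mul_nonneg (by positivity) (decay_pos x).le), decay,
        Real.rpow_neg (by positivity), ← div_eq_mul_inv, div_le_iff₀ (by positivity)]
      linarith
    · have : (0 : ℝ) < 1 + ‖x‖ ^ ((n : ℝ) + α) := by positivity
      simp only; field_simp
  dual := by
    intro x₀ δ hδ
    let φ : Eucl n → ℝ := fun z => unitBump n (δ⁻¹ • (z - x₀))
    have hφ : ContDiff ℝ ∞ φ := (unitBump n).contDiff.comp (by fun_prop)
    have hφc : HasCompactSupport φ := by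
      refine HasCompactSupport.of_support_subset_isCompact (isCompact_closedBall x₀ δ) ?_
      intro z hz
      by_contra h
      refine hz (unitBump_eq_zero ?_)
      rw [mem_closedBall, dist_eq_norm, not_le] at h
      rw [norm_smul, norm_inv, Real.norm_of_nonneg hδ.le, inv_mul_eq_div, one_le_div hδ]
      exact h.le
    have h := hu φ hφ hφc (fracLap n α φ) (isFracLapAt_fracLap hn hα0 hα2 hφ hφc)
    simp only [φ, fracLap_comp_affine (unitBump n) x₀ _ hδ, mul_left_comm (u _)] at h
    rw [integral_const_mul] at h
    exact (mul_eq_zero.1 h).resolve_left (by positivity)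

lemma integrable_mul_decay_comp_add (hα0 : 0 < α) (hu : Integrable fun x => u x * decay α x)
    (h : Eucl n) : Integrable fun x => u (x + h) * decay α x := by
  have h1 := (integrable_mul_decay_affine hα0 hu h one_pos).comp_add_right h
  simpa using h1

lemma BumpHarmonic.comp_add (hα0 : 0 < α) (hu : BumpHarmonic α u) (h : Eucl n) :
    BumpHarmonic α fun x => u (x + h) where
  integrable := integrable_mul_decay_comp_add hα0 hu.integrable h
  dual := by
    intro x₀ δ hδ
    rw [← hu.dual (x₀ + h) δ hδ,
      ← integral_add_right_eq_self (fun x => u x * bumpLap n α (δ⁻¹ • (x - (x₀ + h)))) h]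
    simp

lemma BumpHarmonic.const_mul_sub (hn : 1 ≤ n) (hα0 : 0 < α) (hα2 : α < 2)
    (hu : BumpHarmonic α u) (hw : BumpHarmonic α w) (m : ℝ) :
    BumpHarmonic α fun x => m * u x - w x where
  integrable := by
    simp only [sub_mul, mul_assoc]
    exact (hu.integrable.const_mul m).sub hw.integrable
  dual := by
    intro x₀ δ hδ
    have h1 := integrable_mul_bumpLap_affine hn hα0 hα2 hu.integrable x₀ hδ
    have h2 := integrable_mul_bumpLap_affine hn hα0 hα2 hw.integrable x₀ hδ
    simp only [sub_mul, mul_assoc]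
    rw [integral_sub (h1.const_mul m) h2, integral_const_mul, hu.dual x₀ δ hδ, hw.dual x₀ δ hδ]
    simp

lemma integrable_prod_mollify (hα0 : 0 < α) (hρ : Continuous ρ) (hρc : HasCompactSupport ρ)
    (hu : Integrable fun x => u x * decay α x) {G : Eucl n → ℝ} {C : ℝ}
    (hG : AEStronglyMeasurable G) (hC : ∀ x, |G x| ≤ C * decay α x) :
    Integrable (fun p : Eucl n × Eucl n => ρ p.2 * u (p.1 - p.2) * G p.1)
      (volume.prod volume) := by
  have hpc : Continuous fun t : Eucl n => (1 + ‖t‖) ^ ((n : ℝ) + α) :=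
    (by fun_prop : Continuous fun t : Eucl n => 1 + ‖t‖).rpow_const
      fun x => Or.inl (by positivity)
  have hf : Integrable fun t : Eucl n => ρ t * (1 + ‖t‖) ^ ((n : ℝ) + α) :=
    (hρ.mul hpc).integrable_of_hasCompactSupport hρc.mul_right
  have hF := hf.convolution_integrand (ContinuousLinearMap.mul ℝ ℝ) hu
  have hpos : ∀ p : Eucl n × Eucl n,
      0 < decay α (p.1 - p.2) * (1 + ‖p.2‖) ^ ((n : ℝ) + α) :=
    fun p => mul_pos (decay_pos _) (by positivity)
  have hden : Continuous fun p : Eucl n × Eucl n =>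
      (decay α (p.1 - p.2) * (1 + ‖p.2‖) ^ ((n : ℝ) + α))⁻¹ :=
    ((continuous_decay.comp (by fun_prop)).mul (hpc.comp continuous_snd)).inv₀
      fun p => (hpos p).ne'
  have hQ : AEStronglyMeasurable (fun p : Eucl n × Eucl n =>
      G p.1 * (decay α (p.1 - p.2) * (1 + ‖p.2‖) ^ ((n : ℝ) + α))⁻¹) (volume.prod volume) :=
    hG.comp_fst.mul hden.aestronglyMeasurable
  have hC0 : 0 ≤ C := by
    have := (abs_nonneg _).trans (hC 0)
    exact nonneg_of_mul_nonneg_left this (decay_pos _)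
  refine (hF.mul_bdd (c := C) hQ (.of_forall fun p => ?_)).congr (.of_forall fun p => ?_)
  · rw [norm_mul, norm_inv, Real.norm_of_nonneg (hpos p).le, ← div_eq_mul_inv,
      div_le_iff₀ (hpos p)]
    refine (hC _).trans (mul_le_mul_of_nonneg_left ?_ hC0)
    have := decay_add_le hα0 (p.1 - p.2) p.2
    rw [sub_add_cancel] at this
    linarith
  · have h1 := (decay_pos (α := α) (p.1 - p.2)).ne'
    have h2 : (1 + ‖p.2‖) ^ ((n : ℝ) + α) ≠ 0 := by positivity
    simp only [ContinuousLinearMap.mul_apply']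
    field_simp

lemma bumpHarmonic_mollify (hn : 1 ≤ n) (hα0 : 0 < α) (hα2 : α < 2) (hρ : Continuous ρ)
    (hρc : HasCompactSupport ρ) (hu : BumpHarmonic α u) : BumpHarmonic α (mollify ρ u) where
  integrable := by
    have h := (integrable_prod_mollify (C := 1) hα0 hρ hρc hu.integrable
      continuous_decay.aestronglyMeasurable
      fun x => by rw [abs_of_pos (decay_pos x), one_mul]).integral_prod_left
    simpa only [integral_mul_const, mollify] using h
  dual := by
    intro x₀ δ hδ
    obtain ⟨C, hC⟩ := exists_bumpLap_affine_le hn hα0 hα2 x₀ hδ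
    have h := integrable_prod_mollify hα0 hρ hρc hu.integrable
      (aestronglyMeasurable_bumpLap_affine x₀ δ) hC
    have hswap := integral_integral_swap
      (f := fun x t => ρ t * u (x - t) * bumpLap n α (δ⁻¹ • (x - x₀))) h
    simp only [integral_mul_const] at hswap
    refine hswap.trans ?_
    have hz : ∀ t, ∫ x, ρ t * u (x - t) * bumpLap n α (δ⁻¹ • (x - x₀)) = 0 := by
      intro t
      have := (hu.comp_add hα0 (-t)).dual x₀ δ hδ
      simp only [mul_assoc]
      rw [integral_const_mul]
      simp only [sub_eq_add_neg] at this ⊢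
      rw [this, mul_zero]
    simp [hz]

lemma exists_integral_decay_le_integral_ball (hn : 1 ≤ n) (hα0 : 0 < α) (hα2 : α < 2) :
    ∃ C, 0 < C ∧ ∀ w : Eucl n → ℝ, BumpHarmonic α w → (∀ᵐ x, 0 ≤ w x) → ∀ (x₀ : Eucl n) (δ : ℝ),
      0 < δ → ∫ x, w x * decay α (δ⁻¹ • (x - x₀)) ≤ C * ∫ x in ball x₀ δ, w x := by
  obtain ⟨C, hC0, hC⟩ := exists_bumpLap_bounds hn hα0 hα2
  set c : ℝ := 2⁻¹ * volume.real (ball (0 : Eucl n) (1 / 2)) with hc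
  have hc0 : 0 < c := by
    have : 0 < volume.real (ball (0 : Eucl n) (1 / 2)) :=
      ENNReal.toReal_pos (measure_ball_pos _ _ (by norm_num)).ne' measure_ball_lt_top.ne
    positivity
  refine ⟨(c + C) / c, by positivity, fun w hw hw0 x₀ δ hδ => ?_⟩
  have hI1 := (integrable_mul_decay_affine hα0 hw.integrable x₀ hδ).const_mul c
  have hI2 := integrable_mul_bumpLap_affine hn hα0 hα2 hw.integrable x₀ hδ
  have hwb : IntegrableOn w (ball x₀ δ) :=
    ((locallyIntegrable_of_integrable_mul_decay hw.integrable).integrableOn_isCompact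
      (isCompact_closedBall x₀ δ)).mono_set ball_subset_closedBall
  have hI3 : Integrable ((ball x₀ δ).indicator fun x => (c + C) * w x) :=
    (integrable_indicator_iff measurableSet_ball).2 (Integrable.const_mul hwb (c + C))
  have key : ∫ x, (c * (w x * decay α (δ⁻¹ • (x - x₀))) + w x * bumpLap n α (δ⁻¹ • (x - x₀)))
      ≤ ∫ x, (ball x₀ δ).indicator (fun x => (c + C) * w x) x := by
    refine integral_mono_ae (hI1.add hI2) hI3 ?_
    filter_upwards [hw0] with x hx
    set ξ : Eucl n := δ⁻¹ • (x - x₀) with hξ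
    have hξn : ‖ξ‖ = ‖x - x₀‖ / δ := by
      rw [hξ, norm_smul, norm_inv, Real.norm_of_nonneg hδ.le, inv_mul_eq_div]
    have hd1 := decay_le_one hα0 ξ
    have hd0 := decay_pos (α := α) ξ
    by_cases hb : x ∈ ball x₀ δ
    · rw [Set.indicator_of_mem hb]
      have h1 : bumpLap n α ξ ≤ C :=
        (le_abs_self _).trans ((hC ξ).trans (mul_le_of_le_one_right hC0.le hd1))
      have h2 : c * decay α ξ ≤ c := mul_le_of_le_one_right hc0.le hd1
      have h3 := mul_le_mul_of_nonneg_left (add_le_add h2 h1) hx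
      show c * (w x * decay α ξ) + w x * bumpLap n α ξ ≤ (c + C) * w x
      linarith
    · rw [Set.indicator_of_notMem hb]
      rw [mem_ball, dist_eq_norm, not_lt] at hb
      have h1 := bumpLap_le_neg hn hα0 hα2 (x := ξ) (by rw [hξn, one_le_div hδ]; exact hb)
      rw [← hc] at h1
      have h3 := mul_le_mul_of_nonneg_left h1 hx
      show c * (w x * decay α ξ) + w x * bumpLap n α ξ ≤ 0
      linarith
  rw [integral_add hI1 hI2, hw.dual x₀ δ hδ, integral_const_mul, add_zero,
    integral_indicator measurableSet_ball, integral_const_mul] at key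
  rw [div_mul_eq_mul_div, le_div_iff₀ hc0]
  linarith

end BumpHarmonic

/-- The weighted average of `w` around `x` with weight `decay α`. -/
def decayAvg {n : ℕ} (α : ℝ) (w : Eucl n → ℝ) (x : Eucl n) : ℝ :=
  ∫ y, w y * decay α (y - x)

section Harnack

variable {n : ℕ} {α : ℝ} {u w ρ : Eucl n → ℝ}

lemma integrable_mul_decay_sub (hα0 : 0 < α) (hw : Integrable fun x => w x * decay α x)
    (x : Eucl n) : Integrable fun y => w y * decay α (y - x) := by
  simpa using integrable_mul_decay_affine hα0 hw x one_pos

lemma decayAvg_add_le (hα0 : 0 < α) (hw : Integrable fun x => w x * decay α x)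
    (hw0 : ∀ᵐ x, 0 ≤ w x) (x h : Eucl n) :
    decayAvg α w (x + h) ≤ (1 + ‖h‖) ^ ((n : ℝ) + α) * decayAvg α w x := by
  unfold decayAvg
  rw [← integral_const_mul]
  refine integral_mono_ae (integrable_mul_decay_sub hα0 hw _)
    ((integrable_mul_decay_sub hα0 hw _).const_mul _) ?_
  filter_upwards [hw0] with y hy
  have h1 := decay_add_le hα0 (y - x) (-h)
  rw [norm_neg, ← sub_eq_add_neg, sub_sub] at h1
  have := mul_le_mul_of_nonneg_left h1 hy
  linarith

lemma exists_le_decay (hρ : Continuous ρ) (hρc : HasCompactSupport ρ) :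
    ∃ C, 0 < C ∧ ∀ x, |ρ x| ≤ C * decay α x := by
  have hc : Continuous fun x => ρ x * (decay α x)⁻¹ :=
    hρ.mul (continuous_decay.inv₀ fun x => (decay_pos x).ne')
  obtain ⟨C, hC⟩ := (HasCompactSupport.mul_right (f' := fun x => (decay α x)⁻¹)
    hρc).exists_bound_of_continuous hc
  have hC0 : 0 ≤ C := (norm_nonneg _).trans (hC 0)
  refine ⟨C + 1, by positivity, fun x => ?_⟩
  have h : |ρ x * (decay α x)⁻¹| ≤ C := hC x
  have hd := decay_pos (α := α) x
  rw [abs_mul, abs_inv, abs_of_pos hd, ← div_eq_mul_inv, div_le_iff₀ hd] at h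
  nlinarith

lemma exists_abs_secDiff_le_decay (hα0 : 0 < α) (hρ : ContDiff ℝ ∞ ρ)
    (hρc : HasCompactSupport ρ) :
    ∃ C, 0 < C ∧ ∀ x y, ‖y‖ ≤ 1 → |secDiff ρ x y| ≤ C * ‖y‖ ^ 2 * decay α x := by
  obtain ⟨C, hC0, hC⟩ := exists_abs_secDiff_le hρ hρc
  obtain ⟨R, hR0, hR⟩ := hρc.isCompact.isBounded.exists_pos_norm_le
  have hz : ∀ x, R < ‖x‖ → ρ x = 0 := fun x hx => by
    by_contra h
    exact absurd (hR x (subset_tsupport _ h)) (not_le.2 hx)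
  refine ⟨(C + 1) * (R + 2) ^ ((n : ℝ) + α), by positivity, fun x y hy => ?_⟩
  have hd := decay_pos (α := α) x
  by_cases hx : ‖x‖ ≤ R + 1
  · have h1 : decay α (0 : Eucl n) ≤ (R + 2) ^ ((n : ℝ) + α) * decay α x :=
      decay_le_mul hα0 (by positivity) (by simp; linarith)
    have h2 : decay α (0 : Eucl n) = 1 := by simp [decay]
    rw [h2] at h1
    have h3 : 0 ≤ (C + 1) * ‖y‖ ^ 2 := by positivity
    have := mul_le_mul_of_nonneg_left h1 h3
    have := hC x y
    nlinarith [sq_nonneg ‖y‖]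
  · have h1 := norm_sub_le (x + y) y
    have h2 := norm_add_le (x - y) y
    rw [add_sub_cancel_right] at h1
    rw [sub_add_cancel] at h2
    rw [secDiff, hz x (by linarith), hz (x + y) (by linarith), hz (x - y) (by linarith)]
    simp only [mul_zero, sub_zero, abs_zero]
    positivity

lemma mollify_eq (ρ u : Eucl n → ℝ) (x : Eucl n) : mollify ρ u x = ∫ z, u z * ρ (x - z) := by
  unfold mollify
  rw [← integral_sub_left_eq_self _ volume x]
  simp [mul_comm]

lemma integrable_mul_comp_sub (hρ : Continuous ρ) (hρc : HasCompactSupport ρ)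
    (hα0 : 0 < α) (hu : Integrable fun x => u x * decay α x) (x : Eucl n) :
    Integrable fun z => u z * ρ (x - z) := by
  obtain ⟨C, hC0, hC⟩ := exists_le_decay (α := α) hρ hρc
  obtain ⟨D, hD0, hD⟩ := exists_decay_affine_le (n := n) hα0 x one_pos
  refine integrable_mul_of_le_decay (C := C * D) hu
    (hρ.comp (by fun_prop)).aestronglyMeasurable fun z => (hC _).trans ?_
  rw [mul_assoc]
  refine mul_le_mul_of_nonneg_left ?_ hC0.le
  have := hD z
  rwa [inv_one, one_smul, ← decay_neg, neg_sub] at this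

lemma mollify_nonneg (hρ0 : ∀ x, 0 ≤ ρ x) (hu0 : ∀ᵐ x, 0 ≤ u x) (x : Eucl n) :
    0 ≤ mollify ρ u x := by
  rw [mollify_eq]
  refine integral_nonneg_of_ae ?_
  filter_upwards [hu0] with z hz
  exact mul_nonneg hz (hρ0 _)

lemma exists_decayAvg_le_mollify (hn : 1 ≤ n) (hα0 : 0 < α) (hα2 : α < 2)
    (hρ : Continuous ρ) (hρc : HasCompactSupport ρ) (hρ0 : ∀ x, 0 ≤ ρ x) {r c : ℝ} (hr : 0 < r)
    (hr1 : r ≤ 1) (hc : 0 < c) (hρ1 : ∀ x ∈ ball 0 r, c ≤ ρ x)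
    (hu : BumpHarmonic α u) (hu0 : ∀ᵐ x, 0 ≤ u x) :
    ∃ C, 0 < C ∧ ∀ x, decayAvg α u x ≤ C * mollify ρ u x := by
  obtain ⟨C, hC0, hC⟩ := exists_integral_decay_le_integral_ball hn hα0 hα2
  refine ⟨(r ^ ((n : ℝ) + α))⁻¹ * (C * c⁻¹), by positivity, fun x => ?_⟩
  have h1 : r ^ ((n : ℝ) + α) * decayAvg α u x ≤ ∫ y, u y * decay α (r⁻¹ • (y - x)) := by
    unfold decayAvg
    rw [← integral_const_mul]
    refine integral_mono_ae ((integrable_mul_decay_sub hα0 hu.integrable _).const_mul _)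
      (integrable_mul_decay_affine hα0 hu.integrable x hr) ?_
    filter_upwards [hu0] with y hy
    have := mul_le_mul_of_nonneg_left (le_decay_smul hα0 hr hr1 (y - x)) hy
    linarith
  have h2 : c * ∫ y in ball x r, u y ≤ mollify ρ u x := by
    have hI := integrable_mul_comp_sub hρ hρc hα0 hu.integrable x
    have hub : IntegrableOn u (ball x r) :=
      ((locallyIntegrable_of_integrable_mul_decay hu.integrable).integrableOn_isCompact
        (isCompact_closedBall x r)).mono_set ball_subset_closedBall
    rw [mollify_eq, ← integral_const_mul]
    calc ∫ y in ball x r, c * u y ≤ ∫ y in ball x r, u y * ρ (x - y) := by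
          refine setIntegral_mono_on_ae (Integrable.const_mul hub c) hI.integrableOn
            measurableSet_ball ?_
          filter_upwards [hu0] with y hy hyb
          rw [mul_comm]
          refine mul_le_mul_of_nonneg_left (hρ1 _ ?_) hy
          rwa [mem_ball_zero_iff, ← dist_eq_norm, dist_comm]
      _ ≤ _ := by
          refine setIntegral_le_integral hI ?_
          filter_upwards [hu0] with y hy
          exact mul_nonneg hy (hρ0 _)
  have h3 := hC u hu hu0 x r hr
  rw [mul_assoc, ← div_eq_inv_mul, le_div_iff₀ (by positivity)]
  have h4 : ∫ y in ball x r, u y ≤ c⁻¹ * mollify ρ u x := by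
    rw [← div_eq_inv_mul, le_div_iff₀ hc]; linarith
  have := mul_le_mul_of_nonneg_left h4 hC0.le
  linarith

lemma exists_mollify_le_decayAvg (hα0 : 0 < α) (hρ : Continuous ρ) (hρc : HasCompactSupport ρ)
    (hu : Integrable fun x => u x * decay α x) (hu0 : ∀ᵐ x, 0 ≤ u x) :
    ∃ C, 0 < C ∧ ∀ x, mollify ρ u x ≤ C * decayAvg α u x := by
  obtain ⟨C, hC0, hC⟩ := exists_le_decay (α := α) hρ hρc
  refine ⟨C, hC0, fun x => ?_⟩
  rw [mollify_eq, decayAvg, ← integral_const_mul]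
  refine integral_mono_ae (integrable_mul_comp_sub hρ hρc hα0 hu x)
    ((integrable_mul_decay_sub hα0 hu _).const_mul _) ?_
  filter_upwards [hu0] with y hy
  have h1 := (le_abs_self _).trans (hC (x - y))
  rw [← decay_neg, neg_sub] at h1
  have := mul_le_mul_of_nonneg_left h1 hy
  linarith

lemma exists_abs_secDiff_mollify_le (hα0 : 0 < α) (hρ : ContDiff ℝ ∞ ρ)
    (hρc : HasCompactSupport ρ) (hu : Integrable fun x => u x * decay α x)
    (hu0 : ∀ᵐ x, 0 ≤ u x) :
    ∃ C, 0 < C ∧ ∀ x y, ‖y‖ ≤ 1 → |secDiff (mollify ρ u) x y| ≤ C * ‖y‖ ^ 2 * decayAvg α u x := by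
  obtain ⟨C, hC0, hC⟩ := exists_abs_secDiff_le_decay hα0 hρ hρc
  refine ⟨C, hC0, fun x y hy => ?_⟩
  have hI := integrable_mul_comp_sub hρ.continuous hρc hα0 hu
  have h1 : secDiff (mollify ρ u) x y = ∫ z, u z * secDiff ρ (x - z) y := by
    simp only [secDiff, mollify_eq]
    have hI2 : Integrable fun z => 2 * (u z * ρ (x - z)) - u z * ρ (x + y - z) :=
      ((hI x).const_mul 2).sub (hI (x + y))
    rw [← integral_const_mul, ← integral_sub ((hI x).const_mul 2) (hI (x + y)),
      ← integral_sub hI2 (hI (x - y))]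
    refine integral_congr_ae (.of_forall fun z => ?_)
    simp only [sub_add_eq_add_sub, sub_right_comm x y z]
    ring
  rw [h1, decayAvg, ← integral_const_mul, ← Real.norm_eq_abs]
  refine norm_integral_le_of_norm_le ((integrable_mul_decay_sub hα0 hu _).const_mul _) ?_
  filter_upwards [hu0] with z hz
  have h2 := hC (x - z) y hy
  rw [← decay_neg (x - z), neg_sub] at h2
  rw [norm_mul, Real.norm_of_nonneg hz, Real.norm_eq_abs]
  have := mul_le_mul_of_nonneg_left h2 hz
  linarith

lemma exists_decayAvg_le_of_secDiff_le (hn : 1 ≤ n) (hα0 : 0 < α) (hα2 : α < 2) :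
    ∃ C, 0 < C ∧ ∀ w : Eucl n → ℝ, BumpHarmonic α w → (∀ x, 0 ≤ w x) → ∀ (x : Eucl n) (a b δ : ℝ),
      w x ≤ a → 0 ≤ b → (∀ y, ‖y‖ ≤ 1 → |secDiff w x y| ≤ b * ‖y‖ ^ 2) → 0 < δ → δ ≤ 1 →
      decayAvg α w x ≤ C * (δ ^ α)⁻¹ * (2 * a + b * δ ^ 2) := by
  obtain ⟨C, hC0, hC⟩ := exists_integral_decay_le_integral_ball hn hα0 hα2
  have hv0 : 0 < volume.real (ball (0 : Eucl n) 1) :=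
    ENNReal.toReal_pos (measure_ball_pos _ _ one_pos).ne' measure_ball_lt_top.ne
  refine ⟨C * volume.real (ball (0 : Eucl n) 1), by positivity,
    fun w hw hw0 x a b δ ha hb hs hδ hδ1 => ?_⟩
  have h1 : δ ^ ((n : ℝ) + α) * decayAvg α w x ≤ ∫ y, w y * decay α (δ⁻¹ • (y - x)) := by
    unfold decayAvg
    rw [← integral_const_mul]
    refine integral_mono ((integrable_mul_decay_sub hα0 hw.integrable _).const_mul _)
      (integrable_mul_decay_affine hα0 hw.integrable x hδ) fun y => ?_
    have := mul_le_mul_of_nonneg_left (le_decay_smul hα0 hδ hδ1 (y - x)) (hw0 y)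
    linarith
  have hwb : IntegrableOn w (ball x δ) :=
    ((locallyIntegrable_of_integrable_mul_decay hw.integrable).integrableOn_isCompact
      (isCompact_closedBall x δ)).mono_set ball_subset_closedBall
  have hvol : volume.real (ball x δ) = δ ^ n * volume.real (ball (0 : Eucl n) 1) := by
    rw [measureReal_def, Measure.addHaar_ball_of_pos volume x hδ, ENNReal.toReal_mul,
      ENNReal.toReal_ofReal (by positivity), measureReal_def]
    simp
  have h2 : ∫ y in ball x δ, w y
      ≤ δ ^ n * volume.real (ball (0 : Eucl n) 1) * (2 * a + b * δ ^ 2) := by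
    calc ∫ y in ball x δ, w y ≤ ∫ y in ball x δ, (2 * a + b * δ ^ 2) := by
          refine setIntegral_mono_on hwb (integrableOn_const measure_ball_lt_top.ne)
            measurableSet_ball fun y hy => ?_
          rw [mem_ball, dist_eq_norm] at hy
          have h3 := (abs_le.1 (hs (y - x) (by linarith))).1
          have h4 : b * ‖y - x‖ ^ 2 ≤ b * δ ^ 2 := by gcongr
          simp only [secDiff, add_sub_cancel] at h3
          linarith [hw0 (x - (y - x))]
      _ = _ := by simp [hvol]
  have h3 := (h1.trans (hC w hw (.of_forall hw0) x δ hδ)).trans (mul_le_mul_of_nonneg_left h2 hC0.le)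
  rw [Real.rpow_add hδ, Real.rpow_natCast] at h3
  have hδn : 0 < δ ^ n := by positivity
  have hδα : 0 < δ ^ α := by positivity
  rw [mul_right_comm, ← div_eq_mul_inv, le_div_iff₀ hδα]
  refine le_of_mul_le_mul_left ?_ hδn
  linarith

end Harnack

lemma exists_rpow_add_one_lt_pow {a β M : ℝ} (ha : 0 ≤ a) (hM : 1 < M) :
    ∃ k : ℕ, (1 + k * a) ^ β + 1 < M ^ k := by
  obtain ⟨N, hN⟩ := exists_nat_ge β
  have h1 : Tendsto (fun k : ℕ => ((k + 1 : ℕ) : ℝ) ^ N / M ^ (k + 1)) atTop (𝓝 0) :=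
    (tendsto_pow_const_div_const_pow_of_one_lt N hM).comp (tendsto_add_atTop_nat 1)
  have hM0 : 0 < M := one_pos.trans hM
  have h2 : 0 < (2 * (1 + a) ^ N * M)⁻¹ := by positivity
  obtain ⟨k, hk⟩ := (h1.eventually (gt_mem_nhds h2)).exists
  refine ⟨k, ?_⟩
  have hk0 : (0 : ℝ) ≤ k := k.cast_nonneg
  have h3 : (1 : ℝ) ≤ 1 + k * a := by nlinarith
  have h4 : (1 + k * a) ^ β ≤ (1 + k * a) ^ N := by
    rw [← Real.rpow_natCast]
    exact Real.rpow_le_rpow_of_exponent_le h3 hN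
  have h5 : (1 + k * a) ^ N ≤ (1 + a) ^ N * ((k + 1 : ℕ) : ℝ) ^ N := by
    rw [← mul_pow]
    gcongr
    push_cast
    nlinarith
  have h6 : (1 : ℝ) ≤ (1 + k * a) ^ N := one_le_pow₀ h3
  rw [div_lt_iff₀ (by positivity), ← div_eq_inv_mul, lt_div_iff₀ (by positivity), pow_succ M] at hk
  refine lt_of_mul_lt_mul_right ?_ hM0.le
  nlinarith

lemma exists_pos_not_forall_mul_sub_le {M : ℝ} (A : ℕ → ℝ) (hA0 : ∀ k, 0 ≤ A k) (hM : 1 < M)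
    (hA : ∃ k, A k + 1 < M ^ k) :
    ∃ τ, 0 < τ ∧ ∀ f : ℕ → ℝ, 0 < f 0 → (∀ k, f k ≤ A k * f 0) →
      ¬ ∀ k, M * f k - τ * A k * f 0 ≤ f (k + 1) := by
  have key : ∀ K : ℕ, ∃ S, 0 ≤ S ∧ ∀ τ, ∀ f : ℕ → ℝ,
      (∀ k, M * f k - τ * A k * f 0 ≤ f (k + 1)) → (M ^ K - τ * S) * f 0 ≤ f K := by
    intro K
    induction K with
    | zero => exact ⟨0, le_rfl, fun τ f _ => by simp⟩
    | succ K ih =>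
      obtain ⟨S, hS0, hS⟩ := ih
      have := hA0 K
      refine ⟨M * S + A K, by positivity, fun τ f hf => ?_⟩
      have h1 := mul_le_mul_of_nonneg_left (hS τ f hf) (one_pos.trans hM).le
      have h2 := hf K
      rw [pow_succ]
      linarith
  obtain ⟨K, hK⟩ := hA
  obtain ⟨S, hS0, hS⟩ := key K
  refine ⟨(S + 1)⁻¹, by positivity, fun f hf0 hfA hf => ?_⟩
  have h1 := (hS _ f hf).trans (hfA K)
  have h2 : (S + 1)⁻¹ * S ≤ 1 := by
    rw [inv_mul_le_iff₀ (by positivity)]; linarith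
  have := le_of_mul_le_mul_right h1 hf0
  linarith

section Liouville

variable {n : ℕ} {α : ℝ} {u V ρ : Eucl n → ℝ}

lemma decayAvg_comp_add (x h : Eucl n) :
    decayAvg α (fun y => V (y + h)) x = decayAvg α V (x + h) := by
  unfold decayAvg
  rw [← integral_add_right_eq_self (fun y => V y * decay α (y - (x + h))) h]
  simp only [add_sub_add_right_eq_sub]

lemma exists_mul_le_decayAvg (hα0 : 0 < α) (hV : Integrable fun x => V x * decay α x)
    {C : ℝ} (hC : 0 < C)
    (hVC : ∀ x h, V (x + h) ≤ C * (1 + ‖h‖) ^ ((n : ℝ) + α) * V x) :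
    ∃ c, 0 < c ∧ ∀ x, c * V x ≤ decayAvg α V x := by
  have hd : Integrable (decay α : Eucl n → ℝ) :=
    integrable_one_add_norm (by simpa using hα0)
  have hd2 : Integrable fun x : Eucl n => decay α x * decay α x :=
    hd.mul_bdd (c := 1) continuous_decay.aestronglyMeasurable (.of_forall fun x => by
      rw [Real.norm_of_nonneg (decay_pos x).le]; exact decay_le_one hα0 x)
  have hpos : 0 < ∫ x : Eucl n, decay α x * decay α x := by
    rw [integral_pos_iff_support_of_nonneg
      (fun x => (mul_pos (decay_pos x) (decay_pos x)).le) hd2]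
    have : (Function.support fun x : Eucl n => decay α x * decay α x) = Set.univ :=
      Set.eq_univ_of_forall fun x => (mul_pos (decay_pos x) (decay_pos x)).ne'
    rw [this]
    exact Measure.measure_univ_pos.2 (NeZero.ne _)
  refine ⟨C⁻¹ * ∫ x : Eucl n, decay α x * decay α x, by positivity, fun x => ?_⟩
  rw [← integral_sub_right_eq_self _ x, mul_right_comm, ← integral_const_mul, decayAvg]
  refine integral_mono ((hd2.comp_sub_right x).const_mul _) (integrable_mul_decay_sub hα0 hV x)
    fun y => ?_
  have h1 := hVC y (-(y - x))
  have hp : 0 < (1 + ‖y - x‖) ^ ((n : ℝ) + α) := by positivity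
  have h2 : C⁻¹ * V x * decay α (y - x) ≤ V y := by
    rw [neg_sub, add_sub_cancel, norm_sub_rev] at h1
    rw [decay, Real.rpow_neg (by positivity), ← div_eq_mul_inv, div_le_iff₀ hp,
      inv_mul_le_iff₀ hC]
    linarith
  have := mul_le_mul_of_nonneg_right h2 (decay_pos (α := α) (y - x)).le
  linarith

lemma exists_mul_sq_rpow_le (hα2 : α < 2) {B t : ℝ} (ht : 0 < t) :
    ∃ δ : ℝ, 0 < δ ∧ δ ≤ 1 ∧ (δ ^ α)⁻¹ * (B * δ ^ 2) ≤ t := by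
  have h1 : Tendsto (fun δ : ℝ => B * δ ^ (2 - α)) (𝓝[>] 0) (𝓝 0) := by
    have : Tendsto (fun δ : ℝ => B * δ ^ (2 - α)) (𝓝 0) (𝓝 (B * 0 ^ (2 - α))) :=
      (Real.continuousAt_rpow_const _ _ (Or.inr (by linarith))).tendsto.const_mul B
    rw [Real.zero_rpow (by linarith), mul_zero] at this
    exact this.mono_left nhdsWithin_le_nhds
  obtain ⟨δ, h2, hδ0, hδ1⟩ :=
    ((h1.eventually (ge_mem_nhds ht)).and (Ioc_mem_nhdsGT one_pos)).exists
  refine ⟨δ, hδ0, hδ1, le_of_eq_of_le ?_ h2⟩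
  rw [Real.rpow_sub hδ0, Real.rpow_two]
  ring

lemma BumpHarmonic.add_le (hn : 1 ≤ n) (hα0 : 0 < α) (hα2 : α < 2) (hV : BumpHarmonic α V)
    (hV0 : ∀ x, 0 ≤ V x) {C : ℝ} (hC : 0 < C)
    (hVC : ∀ x h, V (x + h) ≤ C * (1 + ‖h‖) ^ ((n : ℝ) + α) * V x)
    (hVS : ∀ x y, ‖y‖ ≤ 1 → |secDiff V x y| ≤ C * ‖y‖ ^ 2 * V x) (x h : Eucl n) :
    V (x + h) ≤ V x := by
  by_contra! hx
  have hpos : ∀ y, 0 < V (y + h) → 0 < V y := fun y hy => by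
    refine (hV0 y).lt_of_ne fun h0 => ?_
    have := hVC y h
    rw [← h0, mul_zero] at this
    linarith
  let S : Set ℝ := {m | ∀ y, V (y + h) ≤ m * V y}
  have hSc : IsClosed S := by
    simp only [S, Set.ofPred_forall]
    exact isClosed_iInter fun y => isClosed_le continuous_const (by fun_prop)
  have hx0 := hpos x ((hV0 x).trans_lt hx)
  have hSb : BddBelow S := ⟨1, fun m hm => by
    by_contra! h1
    have := hm x
    nlinarith⟩
  have hMS : sInf S ∈ S := hSc.csInf_mem ⟨_, fun y => hVC y h⟩ hSb
  set M := sInf S with hMdef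
  have hM : 1 < M := by
    by_contra! h1
    have := hMS x
    nlinarith
  have hM0 : 0 < M := one_pos.trans hM
  obtain ⟨c, hc0, hc⟩ := exists_mul_le_decayAvg hα0 hV.integrable hC hVC
  obtain ⟨D, hD0, hD⟩ := exists_decayAvg_le_of_secDiff_le (n := n) hn hα0 hα2
  obtain ⟨k, hk⟩ := exists_rpow_add_one_lt_pow (β := (n : ℝ) + α) (norm_nonneg h) hM
  obtain ⟨τ, hτ0, hτ⟩ := exists_pos_not_forall_mul_sub_le
    (fun k : ℕ => (1 + k * ‖h‖) ^ ((n : ℝ) + α)) (fun k => by positivity) hM ⟨k, hk⟩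
  obtain ⟨δ, hδ0, hδ1, hδ⟩ := exists_mul_sq_rpow_le (α := α) hα2
    (B := 2 * M * C) (t := τ * c / (2 * D)) (by positivity)
  have hδα : 0 < δ ^ α := by positivity
  obtain ⟨ε, hε0, hε⟩ : ∃ ε, 0 < ε ∧ (δ ^ α)⁻¹ * (2 * ε) = τ * c / (2 * D) :=
    ⟨δ ^ α * (τ * c / (2 * D)) / 2, by positivity, by field_simp⟩
  have hMε : M - ε ∉ S := notMem_of_lt_csInf (by linarith) hSb
  simp only [S, Set.mem_ofPred_eq, not_forall, not_le] at hMε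
  obtain ⟨z, hz⟩ := hMε
  have hVz : 0 < V z := by
    refine (hV0 z).lt_of_ne fun h0 => ?_
    have h1 := hVC z h
    rw [← h0, mul_zero] at h1 hz
    linarith
  have hW := (hV.const_mul_sub hn hα0 hα2 (hV.comp_add hα0 h) M)
  have hW0 : ∀ y, 0 ≤ M * V y - V (y + h) := fun y => sub_nonneg.2 (hMS y)
  have hWz : decayAvg α (fun y => M * V y - V (y + h)) z ≤ τ * decayAvg α V z := by
    refine (hD _ hW hW0 z (ε * V z) (2 * M * C * V z) δ (by linarith) (by positivity)
      (fun y hy => ?_) hδ0 hδ1).trans ?_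
    · have h1 : secDiff (fun y => M * V y - V (y + h)) z y
          = M * secDiff V z y - secDiff V (z + h) y := by
        simp only [secDiff, add_right_comm z y h, sub_add_eq_add_sub]
        ring
      rw [h1]
      have h2 := mul_le_mul_of_nonneg_left (hVS z y hy) hM0.le
      have h3 := (hVS (z + h) y hy).trans (mul_le_mul_of_nonneg_left (hMS z) (by positivity))
      have h4 := abs_sub (M * secDiff V z y) (secDiff V (z + h) y)
      rw [abs_mul, abs_of_pos hM0] at h4
      linarith
    · have h1 : D * (δ ^ α)⁻¹ * (2 * (ε * V z) + 2 * M * C * V z * δ ^ 2)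
          = D * ((δ ^ α)⁻¹ * (2 * ε) + (δ ^ α)⁻¹ * (2 * M * C * δ ^ 2)) * V z := by ring
      have h2 : D * ((δ ^ α)⁻¹ * (2 * ε) + (δ ^ α)⁻¹ * (2 * M * C * δ ^ 2)) ≤ τ * c := by
        have h3 : D * (τ * c / (2 * D)) = τ * c / 2 := by field_simp
        have h4 := mul_le_mul_of_nonneg_left hδ hD0.le
        rw [hε]
        linarith
      rw [h1]
      refine (mul_le_mul_of_nonneg_right h2 hVz.le).trans ?_
      rw [mul_assoc]
      exact mul_le_mul_of_nonneg_left (hc z) hτ0.le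
  refine hτ (fun k => decayAvg α V (z + k • h)) ?_ (fun k => ?_) fun k => ?_
  · simpa using (mul_pos hc0 hVz).trans_le (hc z)
  · have := decayAvg_add_le hα0 hV.integrable (.of_forall hV0) z (k • h)
    simpa [← Nat.cast_smul_eq_nsmul ℝ, norm_smul] using this
  · have h1 := decayAvg_add_le hα0 hW.integrable (.of_forall hW0) z (k • h)
    have h2 : decayAvg α (fun y => M * V y - V (y + h)) (z + k • h)
        = M * decayAvg α V (z + k • h) - decayAvg α V (z + (k + 1) • h) := by
      rw [succ_nsmul, ← add_assoc, ← decayAvg_comp_add (V := V) _ h]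
      unfold decayAvg
      rw [← integral_const_mul, ← integral_sub
        ((integrable_mul_decay_sub hα0 hV.integrable _).const_mul M)
        (integrable_mul_decay_sub hα0 (hV.comp_add hα0 h).integrable _)]
      congr! 2
      ring
    have h3 : ‖k • h‖ = k * ‖h‖ := by simp [← Nat.cast_smul_eq_nsmul ℝ, norm_smul]
    rw [h2, h3] at h1
    have h4 := mul_le_mul_of_nonneg_left hWz
      (by positivity : 0 ≤ (1 + k * ‖h‖) ^ ((n : ℝ) + α))
    simp only [zero_smul, add_zero]
    linarith

lemma mollify_eq_mollify (hn : 1 ≤ n) (hα0 : 0 < α) (hα2 : α < 2) (hρ : ContDiff ℝ ∞ ρ)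
    (hρc : HasCompactSupport ρ) (hρ0 : ∀ x, 0 ≤ ρ x) {r c : ℝ} (hr : 0 < r) (hr1 : r ≤ 1)
    (hc : 0 < c) (hρ1 : ∀ x ∈ ball 0 r, c ≤ ρ x) (hu : BumpHarmonic α u) (hu0 : ∀ᵐ x, 0 ≤ u x)
    (x y : Eucl n) : mollify ρ u x = mollify ρ u y := by
  obtain ⟨C₁, hC₁, h₁⟩ :=
    exists_decayAvg_le_mollify hn hα0 hα2 hρ.continuous hρc hρ0 hr hr1 hc hρ1 hu hu0
  obtain ⟨C₂, hC₂, h₂⟩ := exists_mollify_le_decayAvg hα0 hρ.continuous hρc hu.integrable hu0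
  obtain ⟨C₃, hC₃, h₃⟩ := exists_abs_secDiff_mollify_le hα0 hρ hρc hu.integrable hu0
  have hV0 := mollify_nonneg hρ0 hu0
  have key : ∀ x h, mollify ρ u (x + h) ≤ mollify ρ u x := by
    refine BumpHarmonic.add_le hn hα0 hα2 (bumpHarmonic_mollify hn hα0 hα2 hρ.continuous hρc hu)
      hV0 (C := C₂ * C₁ + C₃ * C₁) (by positivity) (fun x h => ?_) (fun x y hy => ?_)
    · calc mollify ρ u (x + h) ≤ C₂ * decayAvg α u (x + h) := h₂ _
        _ ≤ C₂ * ((1 + ‖h‖) ^ ((n : ℝ) + α) * (C₁ * mollify ρ u x)) := by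
          gcongr
          refine (decayAvg_add_le hα0 hu.integrable hu0 x h).trans ?_
          gcongr
          exact h₁ x
        _ ≤ _ := by
          have : 0 ≤ C₃ * C₁ * (1 + ‖h‖) ^ ((n : ℝ) + α) * mollify ρ u x :=
            mul_nonneg (by positivity) (hV0 x)
          linarith
    · refine (h₃ x y hy).trans ?_
      have h4 := mul_le_mul_of_nonneg_left (h₁ x) (by positivity : 0 ≤ C₃ * ‖y‖ ^ 2)
      have : 0 ≤ C₂ * C₁ * ‖y‖ ^ 2 * mollify ρ u x := mul_nonneg (by positivity) (hV0 x)
      linarith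
  refine le_antisymm ?_ ?_
  · simpa using key y (x - y)
  · simpa using key x (y - x)

/-- A shrinking sequence of bump functions at the origin. -/
def shrinkingBump (n i : ℕ) : ContDiffBump (0 : Eucl n) :=
  ⟨1 / (i + 1), 2 * (1 / (i + 1)), by positivity, by
    have : (0 : ℝ) < 1 / (i + 1) := by positivity
    linarith⟩

lemma BumpHarmonic.ae_eq_const (hn : 1 ≤ n) (hα0 : 0 < α) (hα2 : α < 2) (hu : BumpHarmonic α u)
    (hu0 : ∀ᵐ x, 0 ≤ u x) : ∃ c, ∀ᵐ x, u x = c := by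
  have hlim : ∀ᵐ x, Tendsto (fun i => mollify ((shrinkingBump n i).normed volume) u x) atTop
      (𝓝 (u x)) := by
    refine ContDiffBump.ae_convolution_tendsto_right_of_locallyIntegrable (μ := volume) (K := 2) ?_
      (.of_forall fun i => le_rfl) (locallyIntegrable_of_integrable_mul_decay hu.integrable)
    simpa [shrinkingBump] using tendsto_one_div_add_atTop_nhds_zero_nat.const_mul (2 : ℝ)
  have hconst : ∀ i x y, mollify ((shrinkingBump n i).normed volume) u x
      = mollify ((shrinkingBump n i).normed volume) u y := by
    intro i
    let φ := shrinkingBump n i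
    refine mollify_eq_mollify hn hα0 hα2 φ.contDiff_normed φ.hasCompactSupport_normed
      (fun x => φ.nonneg_normed x) φ.rIn_pos ?_
      (inv_pos.2 (φ.integral_pos (μ := volume))) (fun x hx => ?_) hu hu0
    · have : (0 : ℝ) ≤ i := i.cast_nonneg
      exact (div_le_one (by positivity)).2 (by linarith)
    · rw [ContDiffBump.normed_def, φ.one_of_mem_closedBall (ball_subset_closedBall hx), one_div]
  obtain ⟨z, hz⟩ := hlim.exists
  refine ⟨u z, ?_⟩
  filter_upwards [hlim] with x hx
  exact tendsto_nhds_unique (hx.congr fun i => hconst i x z) hz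

end Liouville

/-- Liouville theorem for nonnegative `α`-harmonic functions (Bogdan–Kulczycki–Nowak):
if `n ≥ 2`, `u ∈ L_α` is `α`-harmonic and `u ≥ 0` a.e., then `u` is a.e. constant. -/
theorem alphaHarmonic_nonneg_ae_const (n : ℕ) (hn : 2 ≤ n) (α : ℝ) (hα0 : 0 < α) (hα2 : α < 2)
    (u : EuclideanSpace ℝ (Fin n) → ℝ)
    (hu_L : InLalpha n α u) (hu_harm : AlphaHarmonic n α u)
    (hu_nonneg : ∀ᵐ x : EuclideanSpace ℝ (Fin n), 0 ≤ u x) :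
    ∃ c : ℝ, ∀ᵐ x : EuclideanSpace ℝ (Fin n), u x = c := by
  have h1 : 1 ≤ n := one_le_two.trans hn
  exact (hu_harm.bumpHarmonic h1 hα0 hα2 hu_L).ae_eq_const h1 hα0 hα2 hu_nonneg
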